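/- For every c ∈ F^×: the module cL is again a finitely generated A-submodule of F^r spanning F^r and strongly discrete as a subgroup of F_∞^r, and for every ω ∈ K^r with ω_1,…,ω_r linearly independent over F_∞ and arbitrary choices of representative sets in the definitions of Δ^{cL}_N(ω) and Δ^L_N(ω) (with the same N*), one has Δ^{cL}_N(ω) = c^{1−q^{r·deg(N)}}·Δ^L_N(ω). (Proposition 16.2(c).) -/

import Mathlib

open scoped BigOperators

/-- The pairing of a row vector `x` with a column vector `ω`: `xω = ∑ i, x i * ω i`. -/
noncomputable def rvPair {K : Type*} [Field K] {r : ℕ} (x ω : Fin r → K) : K :=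
  ∑ i, x i * ω i

/-- A subset `M` of a seminormed additive group is strongly discrete if `M ∩ B` is finite
for every bounded subset `B`. -/
def StronglyDiscrete {E : Type*} [SeminormedAddCommGroup E] (M : Set E) : Prop :=
  ∀ B : Set E, Bornology.IsBounded B → (M ∩ B).Finite

/-- The exponential function `e_Λ(z) = z·∏_{λ ∈ Λ, λ ≠ 0} (1 - z/λ)` of a subset `Λ ⊆ K`. -/
noncomputable def expF {K : Type*} [NormedField K] (Λ : Set K) (z : K) : K :=
  z * ∏' l : {l : K // l ∈ Λ ∧ l ≠ 0}, (1 - z / (l : K))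

/-- `a⁻¹L = {x : a•x ∈ L}`. -/
def invSc {K : Type*} [Field K] {r : ℕ} (a : K) (L : Set (Fin r → K)) : Set (Fin r → K) :=
  {x | a • x ∈ L}

/-- `N⁻¹L = {x : b•x ∈ L for all b ∈ N}`, for an ideal `N` of a subring `A ⊆ K`. -/
def invIdl {K : Type*} [Field K] {A : Subring K} {r : ℕ} (N : Ideal A)
    (L : Set (Fin r → K)) : Set (Fin r → K) :=
  {x | ∀ b : A, b ∈ N → (b : K) • x ∈ L}

/-- `R` contains exactly one element of each coset of `L` in `S` other than `L` itself. -/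
def IsRepSet {K : Type*} [Field K] {r : ℕ} (L S : Set (Fin r → K))
    (R : Finset (Fin r → K)) : Prop :=
  (R : Set (Fin r → K)) ⊆ S \ L ∧ ∀ x ∈ S, x ∉ L → ∃! y, y ∈ R ∧ x - y ∈ L

/-- The discriminant value `a · ∏_{w ∈ R} e_{Lω}(wω)⁻¹`. -/
noncomputable def discVal {K : Type*} [NormedField K] {r : ℕ} (a : K)
    (L : Set (Fin r → K)) (R : Finset (Fin r → K)) (ω : Fin r → K) : K :=
  a * ∏ w ∈ R, (expF ((fun x => rvPair x ω) '' L) (rvPair w ω))⁻¹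

theorem expF_mul_left {K : Type*} [NormedField K] {c : K} (hc : c ≠ 0) (Λ : Set K) (z : K) :
    expF ((fun l => c * l) '' Λ) (c * z) = c * expF Λ z := by
  have hmem (l : K) : (l ∈ Λ ∧ l ≠ 0) ↔
      (Equiv.mulLeft₀ c hc l ∈ (fun l => c * l) '' Λ ∧ Equiv.mulLeft₀ c hc l ≠ 0) := by
    simp [hc]
  unfold expF
  rw [← ((Equiv.mulLeft₀ c hc).subtypeEquiv hmem).tprod_eq, mul_assoc]
  congr 3
  ext l
  simp [mul_div_mul_left _ _ hc]

theorem norm_prod_one_sub_sub_one_le {K ι : Type*} [NormedField K] [IsUltrametricDist K]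
    {u : ι → K} {ε : ℝ} (hε : ε ≤ 1) (s : Finset ι) (hε0 : 0 ≤ ε) (hu : ∀ i ∈ s, ‖u i‖ ≤ ε) :
    ‖∏ i ∈ s, (1 - u i) - 1‖ ≤ ε := by
  classical
  induction s using Finset.induction_on with
  | empty => simpa using hε0
  | insert i s hi ih =>
    have hs := ih fun j hj => hu j (Finset.mem_insert_of_mem hj)
    have hi' := hu i (Finset.mem_insert_self _ _)
    have hprod : ‖∏ i ∈ s, (1 - u i)‖ ≤ 1 := by
      have h := IsUltrametricDist.norm_add_le_max (∏ i ∈ s, (1 - u i) - 1) 1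
      rw [sub_add_cancel, norm_one] at h
      exact h.trans (max_le (hs.trans hε) le_rfl)
    rw [Finset.prod_insert hi,
      show (1 - u i) * ∏ j ∈ s, (1 - u j) - 1 =
        (∏ j ∈ s, (1 - u j) - 1) + -(u i * ∏ j ∈ s, (1 - u j)) by ring]
    refine (IsUltrametricDist.norm_add_le_max _ _).trans (max_le hs ?_)
    rw [norm_neg, norm_mul]
    exact (mul_le_of_le_one_right (norm_nonneg _) hprod).trans hi'

/-- In a complete ultrametric field, `∏ (1 - u i)` converges as soon as `u` tends to zero. -/
theorem multipliable_one_sub_of_finite {K ι : Type*} [NormedField K] [IsUltrametricDist K]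
    [CompleteSpace K] {u : ι → K} (hu : ∀ ε : ℝ, 0 < ε → {i | ε ≤ ‖u i‖}.Finite) :
    Multipliable fun i => 1 - u i := by
  classical
  suffices h : CauchySeq fun s : Finset ι => ∏ i ∈ s, (1 - u i) by
    obtain ⟨p, hp⟩ := cauchySeq_tendsto_of_complete h
    exact ⟨p, by simpa [HasProd] using hp⟩
  set s₁ := (hu 1 one_pos).toFinset
  set C := ‖∏ i ∈ s₁, (1 - u i)‖
  have hC : 0 ≤ C := norm_nonneg _
  rw [Metric.cauchySeq_iff']
  intro ε hε
  set δ := min 1 (ε / (C + 1)) / 2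
  have hδ : 0 < δ := by positivity
  have hδ1 : δ < 1 := (half_lt_self (by positivity)).trans_le (min_le_left _ _)
  have hδε : δ < ε / (C + 1) := (half_lt_self (by positivity)).trans_le (min_le_right _ _)
  refine ⟨(hu δ hδ).toFinset, fun t ht => ?_⟩
  set s := (hu δ hδ).toFinset
  have hs₁ : s₁ ⊆ s := fun i hi => by
    simp only [s₁, s, Set.Finite.mem_toFinset, Set.mem_ofPred_eq] at hi ⊢
    exact hδ1.le.trans hi
  have hnorm : ‖∏ i ∈ s, (1 - u i)‖ = C := by
    rw [← Finset.prod_sdiff hs₁, norm_mul, norm_prod, Finset.prod_eq_one, one_mul]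
    intro i hi
    have hi1 : ‖u i‖ < 1 := by simpa [s₁] using (Finset.mem_sdiff.1 hi).2
    rw [sub_eq_add_neg, IsUltrametricDist.norm_add_eq_max_of_norm_ne_norm] <;>
      simp [hi1.ne', hi1.le]
  rw [dist_eq_norm, ← Finset.prod_sdiff ht, ← sub_one_mul, norm_mul, hnorm]
  have := norm_prod_one_sub_sub_one_le hδ1.le (t \ s) hδ.le (u := u) fun i hi => by
    have : ‖u i‖ < δ := by simpa [s] using (Finset.mem_sdiff.1 hi).2
    exact this.le
  calc _ ≤ δ * C := by gcongr
    _ ≤ δ * (C + 1) := by gcongr; linarith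
    _ < ε := (lt_div_iff₀ (by positivity)).1 hδε

/-- The exponential function of a strongly discrete subgroup `Λ` is `Λ`-periodic. -/
theorem expF_add_of_mem {K : Type*} [NormedField K] [IsUltrametricDist K] [CompleteSpace K]
    {Λ : AddSubgroup K} (hΛ : StronglyDiscrete (Λ : Set K)) (z : K) {l : K} (hl : l ∈ Λ) :
    expF (Λ : Set K) (z + l) = expF (Λ : Set K) z := by
  classical
  let p : K → Prop := fun x => x ∈ (Λ : Set K) ∧ x ≠ 0
  have hmult (z : K) : Multipliable fun x : {x : K // p x} => 1 - z / (x : K) := by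
    refine multipliable_one_sub_of_finite fun ε hε => ?_
    have hfin := hΛ _ (Metric.isBounded_closedBall (x := 0) (r := ‖z‖ / ε))
    refine (hfin.preimage Subtype.val_injective.injOn).subset fun x hx => ?_
    have hx0 : 0 < ‖(x : K)‖ := norm_pos_iff.2 x.2.2
    refine ⟨x.2.1, ?_⟩
    simp only [Set.mem_ofPred_eq, norm_div] at hx
    rw [le_div_iff₀ hx0] at hx
    rw [mem_closedBall_zero_iff, le_div_iff₀ hε]
    linarith
  have hfin (m : ℕ) := hΛ _ (Metric.isBounded_closedBall (x := 0) (r := (m : ℝ)))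
  let T : ℕ → Finset K := fun m => (hfin m).toFinset
  have hT (m : ℕ) (x : K) : x ∈ T m ↔ x ∈ Λ ∧ ‖x‖ ≤ m := by simp [T]
  have htop : Filter.Tendsto (fun m => (T m).subtype p) Filter.atTop Filter.atTop := by
    refine Filter.tendsto_atTop_finset_of_monotone (fun m m' h x hx => ?_) fun x => ?_
    · rw [Finset.mem_subtype, hT] at hx ⊢
      exact ⟨hx.1, hx.2.trans (by exact_mod_cast h)⟩
    · obtain ⟨m, hm⟩ := exists_nat_ge ‖(x : K)‖
      exact ⟨m, by rw [Finset.mem_subtype, hT]; exact ⟨x.2.1, hm⟩⟩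
  have hlim (z : K) : Filter.Tendsto
      (fun m => z * ∏ x ∈ (T m).subtype p, (1 - z / (x : K))) Filter.atTop
      (nhds (expF (Λ : Set K) z)) := by
    have h := (hmult z).hasProd
    simp only [HasProd, SummationFilter.unconditional_filter] at h
    exact (h.comp htop).const_mul z
  have hprod (m : ℕ) (z : K) : z * ∏ x ∈ (T m).subtype p, (1 - z / (x : K)) =
      (∏ x ∈ (T m).erase 0, (-x⁻¹)) * ∏ x ∈ T m, (z - x) := by
    have h0 : (0 : K) ∈ T m := (hT m 0).2 ⟨Λ.zero_mem, by simp⟩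
    have hfilter : (T m).filter p = (T m).erase 0 := by
      ext x
      simp only [Finset.mem_filter, Finset.mem_erase, hT, p, SetLike.mem_coe]
      tauto
    rw [Finset.prod_subtype_eq_prod_filter (fun x => 1 - z / x), hfilter,
      ← Finset.mul_prod_erase _ _ h0, sub_zero, mul_left_comm, ← Finset.prod_mul_distrib]
    congr 1
    refine Finset.prod_congr rfl fun x hx => ?_
    have := Finset.ne_of_mem_erase hx
    field_simp
    ring
  refine tendsto_nhds_unique (hlim (z + l)) ((hlim z).congr' ?_)
  obtain ⟨m₀, hm₀⟩ := exists_nat_ge ‖l‖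
  filter_upwards [Filter.eventually_ge_atTop m₀] with m hm
  have hlm : ‖l‖ ≤ m := hm₀.trans (by exact_mod_cast hm)
  have hadd {x y : K} (hx : x ∈ T m) (hy : y ∈ Λ) (hym : ‖y‖ ≤ m) : x + y ∈ T m := by
    rw [hT] at hx ⊢
    exact ⟨Λ.add_mem hx.1 hy, (IsUltrametricDist.norm_add_le_max _ _).trans (max_le hx.2 hym)⟩
  rw [hprod, hprod]
  congr 1
  refine Finset.prod_nbij' (· + l) (· + -l) (fun x hx => hadd hx hl hlm)
    (fun x hx => hadd hx (Λ.neg_mem hl) (by simpa using hlm)) ?_ ?_ ?_ <;> intros <;> ring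

theorem stronglyDiscrete_smul {K ι : Type*} [NormedField K] [Fintype ι] {c : K} (hc : c ≠ 0)
    {L : Set (ι → K)} (hL : StronglyDiscrete L) :
    StronglyDiscrete ((fun x => c • x) '' L) := by
  intro B hB
  obtain ⟨C, hC⟩ := hB.exists_norm_le
  refine ((hL _ (Metric.isBounded_closedBall (x := 0) (r := C / ‖c‖))).image
    (fun x => c • x)).subset ?_
  rintro _ ⟨⟨x, hx, rfl⟩, hxB⟩
  refine ⟨x, ⟨hx, ?_⟩, rfl⟩
  have := hC _ hxB
  rw [norm_smul] at this
  rw [mem_closedBall_zero_iff, le_div_iff₀ (norm_pos_iff.2 hc)]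
  linarith

/-- If the entries of `ω` are linearly independent over a closed subfield, then `x ↦ xω` maps
strongly discrete sets of vectors over this subfield to strongly discrete sets. -/
theorem stronglyDiscrete_image_rvPair {K : Type*} [NormedField K] [CompleteSpace K]
    {E : Subfield K} (hE : IsClosed (E : Set K)) {r : ℕ} {L : Set (Fin r → K)}
    (hLE : ∀ x ∈ L, ∀ i, x i ∈ E) (hL : StronglyDiscrete L) {ω : Fin r → K}
    (hω : ∀ x : Fin r → K, (∀ i, x i ∈ E) → rvPair x ω = 0 → x = 0) :
    StronglyDiscrete ((fun x => rvPair x ω) '' L) := by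
  by_cases htriv : ∃ x : E, 1 < ‖x‖
  · let _ : NontriviallyNormedField E := { (inferInstance : NormedField E) with
      non_trivial := htriv }
    have : CompleteSpace E := hE.completeSpace_coe
    let _ : NormedSpace E K := { (inferInstance : Module E K) with
      norm_smul_le := fun a x => by
        rw [Subfield.smul_def]
        exact norm_mul_le _ _ }
    let f : (Fin r → E) →ₗ[E] K :=
      { toFun := fun x => rvPair (fun i => (x i : K)) ω
        map_add' := fun x y => by simp [rvPair, add_mul, Finset.sum_add_distrib]
        map_smul' := fun a x => by
          simp [rvPair, Finset.mul_sum, mul_assoc, Subfield.smul_def] }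
    have hf : LinearMap.ker f = ⊥ := by
      rw [LinearMap.ker_eq_bot']
      intro x hx
      have h := hω (fun i => (x i : K)) (fun i => (x i).2) hx
      ext i
      simpa using congrFun h i
    obtain ⟨C, -, hC⟩ := f.exists_antilipschitzWith hf
    intro B hB
    obtain ⟨D, hD⟩ := hB.exists_norm_le
    refine ((hL _ (Metric.isBounded_closedBall (x := 0) (r := C * D))).image
      (fun x => rvPair x ω)).subset ?_
    rintro _ ⟨⟨x, hx, rfl⟩, hxB⟩
    refine ⟨x, ⟨hx, ?_⟩, rfl⟩
    have h : ‖fun i => (⟨x i, hLE x hx i⟩ : E)‖ ≤ C * ‖rvPair x ω‖ := by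
      simpa [f, rvPair] using hC.le_mul_dist (fun i => (⟨x i, hLE x hx i⟩ : E)) 0
    have hC0 : (0 : ℝ) ≤ C := C.2
    have h' := h.trans (mul_le_mul_of_nonneg_left (hD _ hxB) hC0)
    rw [mem_closedBall_zero_iff, pi_norm_le_iff_of_nonneg ((norm_nonneg _).trans h')]
    exact fun i => (norm_le_pi_norm (fun i => (⟨x i, hLE x hx i⟩ : E)) i).trans h'
  · push Not at htriv
    intro B _
    have hfin := hL _ (Metric.isBounded_closedBall (x := 0) (r := 1))
    refine (hfin.image (fun x => rvPair x ω)).subset ?_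
    rintro _ ⟨⟨x, hx, rfl⟩, -⟩
    refine ⟨x, ⟨hx, ?_⟩, rfl⟩
    rw [mem_closedBall_zero_iff, pi_norm_le_iff_of_nonneg zero_le_one]
    exact fun i => htriv ⟨x i, hLE x hx i⟩

open scoped TensorProduct in
/-- A finite torsion-free module of rank `n` over a Dedekind domain satisfies
`|M / N M| = |A / N| ^ n`. -/
theorem card_quotient_ideal_smul_top {A M : Type*} [CommRing A] [IsDedekindDomain A]
    [AddCommGroup M] [Module A M] [Module.Finite A M] [Module.IsTorsionFree A M]
    (N : Ideal A) [Finite (A ⧸ N)] :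
    Nat.card (M ⧸ (N • ⊤ : Submodule A M)) = Nat.card (A ⧸ N) ^ Module.finrank A M := by
  have hrk (P : MaximalSpectrum (A ⧸ N)) : Module.finrank ((A ⧸ N) ⧸ P.1)
      (((A ⧸ N) ⧸ P.1) ⊗[A ⧸ N] ((A ⧸ N) ⊗[A] M)) = Module.finrank A M := by
    have := P.2
    let _ := Ideal.Quotient.field P.1
    have h := congrFun (Module.rankAtStalk_eq_finrank_of_free (R := (A ⧸ N) ⧸ P.1)
      (M := ((A ⧸ N) ⧸ P.1) ⊗[A ⧸ N] ((A ⧸ N) ⊗[A] M))) ⊥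
    rw [Module.rankAtStalk_baseChange, Module.rankAtStalk_baseChange, Module.rankAtStalk_eq,
      Ideal.finrank_fiber_eq_finrank] at h
    simpa using h.symm
  obtain ⟨b⟩ := Module.nonempty_basis_of_flat_of_finrank_eq (A ⧸ N) ((A ⧸ N) ⊗[A] M) _ hrk
  rw [← Nat.card_congr (TensorProduct.quotTensorEquivQuotSMul M N).toEquiv,
    Nat.card_congr b.equivFun.toEquiv, Nat.card_fun, Nat.card_fin]

/-- A system of representatives of the nonzero cosets of `L` in `M` has `|M / L| - 1` elements. -/
theorem IsRepSet.card_add_one {K : Type*} [Field K] {A : Subring K} {r : ℕ}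
    {L M : Submodule A (Fin r → K)} {R : Finset (Fin r → K)}
    (hR : IsRepSet (L : Set (Fin r → K)) M R) :
    R.card + 1 = Nat.card (M ⧸ L.submoduleOf M) := by
  have hmk (x y : M) : (L.submoduleOf M).mkQ x = (L.submoduleOf M).mkQ y ↔
      (x : Fin r → K) - y ∈ L := by
    simp only [Submodule.mkQ_apply, Submodule.Quotient.eq]
    rfl
  let f : Option R → M ⧸ L.submoduleOf M :=
    fun o => o.elim 0 fun w => (L.submoduleOf M).mkQ ⟨w, (hR.1 w.2).1⟩
  have hne (w : R) : f (some w) ≠ 0 := by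
    intro h
    apply (hR.1 w.2).2
    simpa using (hmk ⟨w, (hR.1 w.2).1⟩ 0).1 (h.trans (map_zero _).symm)
  have hf : Function.Bijective f := by
    constructor
    · rintro (_ | v) (_ | w) h
      · rfl
      · exact (hne w h.symm).elim
      · exact (hne v h).elim
      · have hvw := (hmk _ _).1 h
        obtain ⟨y, -, hy⟩ := hR.2 v (hR.1 v.2).1 (hR.1 v.2).2
        have hv := hy v ⟨v.2, by simp⟩
        have hw := hy w ⟨w.2, hvw⟩
        rw [Subtype.ext (hv.trans hw.symm)]
    · intro q
      obtain ⟨x, rfl⟩ := Submodule.mkQ_surjective _ q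
      by_cases hx : (x : Fin r → K) ∈ L
      · refine ⟨none, ?_⟩
        have := (hmk x 0).2 (by simpa using hx)
        rw [this, map_zero]
        rfl
      · obtain ⟨y, ⟨hyR, hy⟩, -⟩ := hR.2 x x.2 hx
        exact ⟨some ⟨y, hyR⟩, ((hmk x ⟨y, (hR.1 hyR).1⟩).2 hy).symm⟩
  rw [← Nat.card_eq_of_bijective f hf, Finite.card_option, Nat.card_eq_finsetCard]

/-- The module `N⁻¹L` for a submodule `L`. -/
def invIdlSubmodule {K : Type*} [Field K] {A : Subring K} {r : ℕ} (N : Ideal A)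
    (L : Submodule A (Fin r → K)) : Submodule A (Fin r → K) where
  carrier := invIdl N (L : Set (Fin r → K))
  add_mem' hx hy b hb := by
    rw [smul_add]
    exact L.add_mem (hx b hb) (hy b hb)
  zero_mem' b _ := by simp
  smul_mem' d x hx b hb := by
    rw [Subring.smul_def, smul_comm]
    exact L.smul_mem d (hx b hb)

theorem mem_invIdlSubmodule {K : Type*} [Field K] {A : Subring K} {r : ℕ} {N : Ideal A}
    {L : Submodule A (Fin r → K)} {x : Fin r → K} :
    x ∈ invIdlSubmodule N L ↔ ∀ b ∈ N, b • x ∈ L :=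
  Iff.rfl

theorem le_invIdlSubmodule {K : Type*} [Field K] {A : Subring K} {r : ℕ} (N : Ideal A)
    (L : Submodule A (Fin r → K)) : L ≤ invIdlSubmodule N L :=
  fun _ hx b _ => L.smul_mem b hx

theorem smul_invIdlSubmodule {K : Type*} [Field K] {A : Subring K} {r : ℕ} {N : Ideal A}
    {n : ℕ} (hn : 1 ≤ n) {a : A} (ha : a ≠ 0) (hN : N ^ n = Ideal.span {a})
    (L : Submodule A (Fin r → K)) : N • invIdlSubmodule N L = L := by
  obtain ⟨m, rfl⟩ := Nat.exists_eq_add_of_le' hn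
  have ha' : (a : K) ≠ 0 := by simpa using ha
  refine le_antisymm (Submodule.smul_le.2 fun b hb x hx => hx b hb) fun x hx => ?_
  set y := (a : K)⁻¹ • x with hy
  have hay : a • y = x := by rw [hy, Subring.smul_def, smul_inv_smul₀ ha']
  have hle : N ^ m • Submodule.span A {y} ≤ invIdlSubmodule N L := by
    refine Submodule.smul_le.2 fun j hj z hz => ?_
    obtain ⟨d, rfl⟩ := Submodule.mem_span_singleton.1 hz
    refine mem_invIdlSubmodule.2 fun b hb => ?_
    have hbj : b * j ∈ N ^ (m + 1) := by
      rw [pow_succ']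
      exact Ideal.mul_mem_mul hb hj
    rw [hN] at hbj
    obtain ⟨e, he⟩ := Ideal.mem_span_singleton'.1 hbj
    rw [smul_smul b j, ← he, smul_comm _ d, mul_smul, hay]
    exact L.smul_mem _ (L.smul_mem _ hx)
  have hmem : a • y ∈ N ^ (m + 1) • Submodule.span A {y} :=
    Submodule.smul_mem_smul (hN ▸ Ideal.mem_span_singleton_self a)
      (Submodule.mem_span_singleton_self y)
  rw [pow_succ', Submodule.mul_smul, hay] at hmem
  exact Submodule.smul_mono le_rfl hle hmem

/-- A submodule of `F^r` spanning `F^r` over the fraction field `F` of `A` has rank `r`. -/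
theorem finrank_eq_of_span {K : Type*} [Field K] {A : Subring K} {F : Subfield K}
    (hAF : (A : Set K) ⊆ F)
    (hFrac : ∀ z ∈ F, ∃ a ∈ A, ∃ b ∈ A, b ≠ 0 ∧ z * b = a) {r : ℕ}
    {M : Submodule A (Fin r → K)} (hMF : ∀ x ∈ M, ∀ i, x i ∈ F)
    (hspan : ∀ y : Fin r → K, (∀ i, y i ∈ F) →
      y ∈ AddSubgroup.closure {z | ∃ c ∈ (F : Set K), ∃ x ∈ M, z = c • x}) :
    Module.finrank A M = r := by
  let _ : Algebra A F := (Subring.inclusion (show A ≤ F.toSubring from hAF)).toAlgebra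
  have hcoe (a : A) : ((algebraMap A F a : F) : K) = a := rfl
  have hcoe' (a : A) : algebraMap A K a = a := rfl
  have : FaithfulSMul A F := by
    rw [faithfulSMul_iff_algebraMap_injective]
    intro a b h
    exact Subtype.ext (congrArg (fun z : F => (z : K)) h)
  have : IsFractionRing A F := by
    refine IsFractionRing.of_field A F fun z => ?_
    obtain ⟨a, ha, b, hb, hb0, h⟩ := hFrac z z.2
    refine ⟨⟨a, ha⟩, ⟨b, hb⟩, Subtype.ext ?_⟩
    rw [Subfield.coe_div, hcoe, hcoe, eq_div_iff hb0]
    exact h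
  have hden {y : Fin r → K} (hy : ∀ i, y i ∈ F) : ∃ b : A, b ≠ 0 ∧ b • y ∈ M := by
    replace hy := hspan y hy
    induction hy using AddSubgroup.closure_induction with
    | mem z hz =>
      obtain ⟨c, hc, x, hx, rfl⟩ := hz
      obtain ⟨a, ha, b, hb, hb0, h⟩ := hFrac c hc
      refine ⟨⟨b, hb⟩, fun h => hb0 (congrArg Subtype.val h), ?_⟩
      have : (⟨b, hb⟩ : A) • c • x = (⟨a, ha⟩ : A) • x := by
        rw [Subring.smul_def, Subring.smul_def, smul_smul, mul_comm, h]
      rw [this]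
      exact M.smul_mem _ hx
    | zero => exact ⟨1, one_ne_zero, by simp⟩
    | add x y _ _ hx hy =>
      obtain ⟨b, hb, hbx⟩ := hx
      obtain ⟨d, hd, hdy⟩ := hy
      refine ⟨b * d, mul_ne_zero hb hd, ?_⟩
      rw [smul_add, mul_smul b d y, mul_comm, mul_smul]
      exact M.add_mem (M.smul_mem _ hbx) (M.smul_mem _ hdy)
    | neg x _ hx =>
      obtain ⟨b, hb, hbx⟩ := hx
      exact ⟨b, hb, by rw [smul_neg]; exact M.neg_mem hbx⟩
  let ψ : M →ₗ[A] (Fin r → F) :=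
    { toFun := fun x i => ⟨(x : Fin r → K) i, hMF x x.2 i⟩
      map_add' := fun _ _ => rfl
      map_smul' := fun a x => by
        ext i
        simp [Algebra.smul_def, hcoe, hcoe'] }
  have : IsLocalizedModule (nonZeroDivisors A) ψ := by
    refine ⟨fun b => ?_, fun y => ?_, fun {x y} h => ⟨1, ?_⟩⟩
    · have hb : algebraMap A F b ≠ 0 := by
        simp
      refine (Module.End.isUnit_iff _).2 ⟨fun x y h => ?_, fun y => ?_⟩
      · ext i
        have := congrFun h i
        simp only [Module.algebraMap_end_apply, Pi.smul_apply, Algebra.smul_def] at this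
        rw [mul_left_cancel₀ hb this]
      · refine ⟨(algebraMap A F b)⁻¹ • y, ?_⟩
        ext i
        simp [Algebra.smul_def]
    · obtain ⟨b, hb, hby⟩ := hden (y := fun i => (y i : K)) fun i => (y i).2
      refine ⟨(⟨⟨_, hby⟩, ⟨b, mem_nonZeroDivisors_of_ne_zero hb⟩⟩), ?_⟩
      ext i
      simp [ψ, Algebra.smul_def, hcoe, hcoe', Submonoid.smul_def]
    · congr 1
      ext i
      exact congrArg (fun z : F => (z : K)) (congrFun h i)
  rw [← IsLocalizedModule.finrank_eq (nonZeroDivisors A) ψ le_rfl,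
    ← IsFractionRing.finrank_right_eq A F, Module.finrank_fin_fun]

/-- For a lattice `L` of rank `r`, a system of representatives of the nonzero cosets of `L` in
`N⁻¹L` has `|A / N| ^ r - 1` elements. -/
theorem card_repSet {K : Type*} [Field K] {A : Subring K} [IsDedekindDomain A] {F : Subfield K}
    (hAF : (A : Set K) ⊆ F) (hFrac : ∀ z ∈ F, ∃ a ∈ A, ∃ b ∈ A, b ≠ 0 ∧ z * b = a) {r : ℕ}
    {L : Submodule A (Fin r → K)} (hLF : ∀ x ∈ L, ∀ i, x i ∈ F)
    (hspan : ∀ y : Fin r → K, (∀ i, y i ∈ F) →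
      y ∈ AddSubgroup.closure {z | ∃ c ∈ (F : Set K), ∃ x ∈ L, z = c • x})
    (hL : L.FG) {N : Ideal A} [Finite (A ⧸ N)]
    {n : ℕ} (hn : 1 ≤ n) {a : A} (ha : a ≠ 0) (hN : N ^ n = Ideal.span {a})
    {R : Finset (Fin r → K)} (hR : IsRepSet (L : Set (Fin r → K)) (invIdl N L) R) :
    R.card + 1 = Nat.card (A ⧸ N) ^ r := by
  set M := invIdlSubmodule N L
  have haN : a ∈ N := Ideal.pow_le_self (by omega) (hN ▸ Ideal.mem_span_singleton_self a)
  have ha' : (a : K) ≠ 0 := by simpa using ha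
  have hLN : IsNoetherian A L := isNoetherian_of_fg_of_noetherian L hL
  let φ : M →ₗ[A] L := ((LinearMap.lsmul A (Fin r → K) a).comp M.subtype).codRestrict L
    fun x => mem_invIdlSubmodule.1 x.2 a haN
  have hφ : Function.Injective φ := fun x y h =>
    Subtype.ext (smul_right_injective _ ha' (congrArg Subtype.val h))
  have : IsNoetherian A M := isNoetherian_of_injective φ hφ
  have hMF : ∀ x ∈ M, ∀ i, x i ∈ F := by
    intro x hx i
    have h := F.mul_mem (F.inv_mem (hAF a.2)) (hLF _ (mem_invIdlSubmodule.1 hx a haN) i)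
    rwa [Subring.smul_def, Pi.smul_apply, smul_eq_mul, inv_mul_cancel_left₀ ha'] at h
  have hMspan : ∀ y : Fin r → K, (∀ i, y i ∈ F) →
      y ∈ AddSubgroup.closure {z | ∃ c ∈ (F : Set K), ∃ x ∈ M, z = c • x} := fun y hy =>
    AddSubgroup.closure_mono (by
      rintro _ ⟨c, hc, x, hx, rfl⟩
      exact ⟨c, hc, x, le_invIdlSubmodule N L hx, rfl⟩) (hspan y hy)
  have hsub : L.submoduleOf M = N • ⊤ := by
    apply Submodule.map_injective_of_injective M.injective_subtype
    rw [Submodule.map_smul'', Submodule.map_top, Submodule.range_subtype,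
      smul_invIdlSubmodule hn ha hN, Submodule.submoduleOf, Submodule.map_comap_subtype,
      inf_eq_right.2 (le_invIdlSubmodule N L)]
  have hcard := IsRepSet.card_add_one (L := L) (M := M) hR
  rw [hcard, hsub, card_quotient_ideal_smul_top, finrank_eq_of_span hAF hFrac hMF hMspan]

theorem IsRepSet.smul {K : Type*} [Field K] [DecidableEq K] {r : ℕ} {c : K} (hc : c ≠ 0)
    {L S : Set (Fin r → K)} {R : Finset (Fin r → K)} (hR : IsRepSet L S R) :
    IsRepSet ((fun x => c • x) '' L) ((fun x => c • x) '' S) (R.image fun x => c • x) := by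
  have hinj : Function.Injective fun x : Fin r → K => c • x := smul_right_injective _ hc
  refine ⟨?_, ?_⟩
  · rw [Finset.coe_image, ← Set.image_sdiff hinj]
    exact Set.image_mono hR.1
  · rintro _ ⟨x, hx, rfl⟩ hxL
    obtain ⟨y, ⟨hyR, hy⟩, huniq⟩ := hR.2 x hx fun h => hxL ⟨x, h, rfl⟩
    refine ⟨c • y, ⟨Finset.mem_image_of_mem _ hyR, x - y, hy, smul_sub c x y⟩, ?_⟩
    rintro _ ⟨hz, v, hv, hvz⟩
    obtain ⟨z, hzR, rfl⟩ := Finset.mem_image.1 hz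
    have : v = x - z := hinj (hvz.trans (smul_sub c x z).symm)
    exact congrArg (fun x => c • x) (huniq z ⟨hzR, this ▸ hv⟩)

theorem invIdl_smul {K : Type*} [Field K] {A : Subring K} {r : ℕ} {N : Ideal A} {c : K}
    (hc : c ≠ 0) {L : Set (Fin r → K)} :
    invIdl N ((fun x => c • x) '' L) = (fun x => c • x) '' invIdl N L := by
  have hmem (T : Set (Fin r → K)) (x : Fin r → K) :
      x ∈ (fun x => c • x) '' T ↔ c⁻¹ • x ∈ T :=
    Set.mem_smul_set_iff_inv_smul_mem₀ hc T x
  ext x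
  rw [hmem]
  refine forall₂_congr fun b _ => ?_
  rw [hmem, smul_comm]

/-- The product of a periodic function over representatives is independent of their choice. -/
theorem IsRepSet.prod_eq {K P : Type*} [Field K] [CommMonoid P] {r : ℕ}
    {L : AddSubgroup (Fin r → K)} {S : Set (Fin r → K)} {R R' : Finset (Fin r → K)}
    (hR : IsRepSet (L : Set (Fin r → K)) S R) (hR' : IsRepSet (L : Set (Fin r → K)) S R')
    {f : (Fin r → K) → P} (hf : ∀ x y, x - y ∈ L → f x = f y) :
    ∏ w ∈ R, f w = ∏ w ∈ R', f w := by
  have hex {Q Q' : Finset (Fin r → K)} (hQ : IsRepSet (L : Set (Fin r → K)) S Q)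
      (hQ' : IsRepSet (L : Set (Fin r → K)) S Q') (w : Fin r → K) (hw : w ∈ Q) :
      ∃ y ∈ Q', w - y ∈ L :=
    let ⟨y, ⟨hy, hwy⟩, _⟩ := hQ'.2 w (hQ.1 hw).1 (hQ.1 hw).2
    ⟨y, hy, hwy⟩
  choose g hg hgL using hex hR hR'
  refine Finset.prod_bij g hg ?_ ?_ fun w hw => hf _ _ (hgL w hw)
  · intro w hw w' hw' h
    have hdiff : w - w' ∈ (L : Set (Fin r → K)) := by
      have := L.sub_mem (hgL w hw) (hgL w' hw')
      rwa [h, sub_sub_sub_cancel_right] at this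
    exact (hR.2 w (hR.1 hw).1 (hR.1 hw).2).unique ⟨hw, by simp [L.zero_mem]⟩ ⟨hw', hdiff⟩
  · intro y hy
    obtain ⟨w, hw, hyw⟩ := hex hR' hR y hy
    refine ⟨w, hw, (hR'.2 y (hR'.1 hy).1 (hR'.1 hy).2).unique ⟨hg w hw, ?_⟩
      ⟨hy, by simp [L.zero_mem]⟩⟩
    have := L.add_mem hyw (hgL w hw)
    rwa [sub_add_sub_cancel] at this

/-- The discriminant value does not depend on the choice of representatives. -/
theorem discVal_congr {K : Type*} [NormedField K] [IsUltrametricDist K] [CompleteSpace K]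
    {r : ℕ} {a : K} {L : AddSubgroup (Fin r → K)} {S : Set (Fin r → K)} {ω : Fin r → K}
    (hL : StronglyDiscrete ((fun x => rvPair x ω) '' (L : Set (Fin r → K))))
    {R R' : Finset (Fin r → K)} (hR : IsRepSet (L : Set (Fin r → K)) S R)
    (hR' : IsRepSet (L : Set (Fin r → K)) S R') :
    discVal a (L : Set (Fin r → K)) R ω = discVal a (L : Set (Fin r → K)) R' ω := by
  let φ : (Fin r → K) →+ K := AddMonoidHom.mk' (fun x => rvPair x ω) fun x y => by
    simp [rvPair, add_mul, Finset.sum_add_distrib]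
  have hφ : (L.map φ : Set K) = (fun x => rvPair x ω) '' (L : Set (Fin r → K)) := rfl
  unfold discVal
  congr 1
  refine hR.prod_eq hR' fun x y hxy => ?_
  rw [← hφ] at hL ⊢
  rw [show rvPair x ω = rvPair y ω + φ (x - y) by rw [map_sub]; exact (add_sub_cancel _ _).symm,
    expF_add_of_mem hL _ (AddSubgroup.mem_map_of_mem φ hxy)]

theorem discVal_smul {K : Type*} [NormedField K] [DecidableEq K] {r : ℕ} {a c : K} (hc : c ≠ 0)
    {L : Set (Fin r → K)} {R : Finset (Fin r → K)} {ω : Fin r → K} :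
    discVal a ((fun x => c • x) '' L) (R.image fun x => c • x) ω =
      c⁻¹ ^ R.card * discVal a L R ω := by
  have hpair (x : Fin r → K) : rvPair (c • x) ω = c * rvPair x ω := by
    simp [rvPair, Finset.mul_sum, mul_assoc]
  have himage : (fun x => rvPair x ω) '' ((fun x => c • x) '' L) =
      (fun l => c * l) '' ((fun x => rvPair x ω) '' L) := by
    simp only [Set.image_image, hpair]
  unfold discVal
  rw [Finset.prod_image ((smul_right_injective _ hc).injOn), himage]
  simp only [hpair, expF_mul_left hc, mul_inv, Finset.prod_mul_distrib, Finset.prod_const]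
  ring

/-- Proposition 16.2(c): `Δ^{cL}_N(ω) = c^{1−q^{r·deg N}}·Δ^L_N(ω)`,
and `cL` is again a finitely generated `A`-submodule of `F^r` spanning `F^r` that is
strongly discrete in `F_∞^r`. -/
theorem disc_scaling
    (K : Type*) [NontriviallyNormedField K] [IsUltrametricDist K] [CompleteSpace K]
    [IsAlgClosed K]
    (Finf : Subfield K) (hFinfclosed : IsClosed (Finf : Set K))
    (hFinfloc : LocallyCompactSpace Finf)
    (Fq : Subfield K) (hFqfin : Finite Fq) (q : ℕ) (hq : Nat.card Fq = q)
    (A : Subring K) (hFqA : (Fq : Set K) ⊆ A)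
    (F : Subfield K) (hAF : (A : Set K) ⊆ F) (hFFinf : F ≤ Finf)
    (hDed : IsDedekindDomain A)
    (hFrac : ∀ z ∈ F, ∃ a ∈ A, ∃ b ∈ A, b ≠ 0 ∧ z * b = a)
    (hquot : ∀ I : Ideal A, I ≠ ⊥ → Finite (A ⧸ I))
    (r : ℕ) (hr : 2 ≤ r)
    (L : Set (Fin r → K))
    (hLsub : ∃ G : AddSubgroup (Fin r → K), (G : Set (Fin r → K)) = L)
    (hLF : ∀ x ∈ L, ∀ i, x i ∈ F)
    (hLA : ∀ a ∈ (A : Set K), ∀ x ∈ L, a • x ∈ L)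
    (hLfg : ∃ T : Finset (Fin r → K), (T : Set (Fin r → K)) ⊆ L ∧
      ∀ x ∈ L, x ∈ AddSubgroup.closure
        {y | ∃ a ∈ (A : Set K), ∃ t ∈ (T : Set (Fin r → K)), y = a • t})
    (hLspan : ∀ y : Fin r → K, (∀ i, y i ∈ F) →
      y ∈ AddSubgroup.closure {z | ∃ c ∈ (F : Set K), ∃ x ∈ L, z = c • x})
    (hLdisc : StronglyDiscrete L)
    (N : Ideal A) (hNne : N ≠ ⊥) (hNpr : N ≠ ⊤)
    (n : ℕ) (hn : 1 ≤ n) (a : A) (ha : a ≠ 0) (hNn : N ^ n = Ideal.span {a})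
    (Nstar : K) (hNstar : Nstar ^ n = (a : K))
    (degN : ℕ) (hdegN : Nat.card (A ⧸ N) = q ^ degN)
    (c : K) (hcF : c ∈ F) (hc : c ≠ 0)
    (ω : Fin r → K)
    (hω : ∀ x : Fin r → K, (∀ i, x i ∈ Finf) → rvPair x ω = 0 → x = 0)
    (R1 R2 : Finset (Fin r → K))
    (hR1 : IsRepSet L (invIdl N L) R1)
    (hR2 : IsRepSet ((fun x => c • x) '' L) (invIdl N ((fun x => c • x) '' L)) R2) :
    -- `cL` is again a finitely generated `A`-submodule of `F^r` spanning `F^r`,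
    -- strongly discrete in `F_∞^r`
    (∃ G : AddSubgroup (Fin r → K), (G : Set (Fin r → K)) = (fun x => c • x) '' L) ∧
    (∀ x ∈ (fun x => c • x) '' L, ∀ i, x i ∈ F) ∧
    (∀ a' ∈ (A : Set K), ∀ x ∈ (fun x => c • x) '' L, a' • x ∈ (fun x => c • x) '' L) ∧
    (∃ T : Finset (Fin r → K), (T : Set (Fin r → K)) ⊆ (fun x => c • x) '' L ∧
      ∀ x ∈ (fun x => c • x) '' L, x ∈ AddSubgroup.closure
        {y | ∃ a' ∈ (A : Set K), ∃ t ∈ (T : Set (Fin r → K)), y = a' • t}) ∧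
    (∀ y : Fin r → K, (∀ i, y i ∈ F) →
      y ∈ AddSubgroup.closure {z | ∃ c' ∈ (F : Set K), ∃ x ∈ (fun x => c • x) '' L, z = c' • x}) ∧
    StronglyDiscrete ((fun x => c • x) '' L) ∧
    -- the discriminant identity
    discVal Nstar ((fun x => c • x) '' L) R2 ω =
      c ^ (1 - (q ^ (r * degN) : ℤ)) * discVal Nstar L R1 ω := by
  classical
  obtain ⟨G, rfl⟩ := hLsub
  have hLd := stronglyDiscrete_smul hc hLdisc
  have hcLF : ∀ x ∈ (fun x => c • x) '' (G : Set (Fin r → K)), ∀ i, x i ∈ F := by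
    rintro _ ⟨x, hx, rfl⟩ i
    exact F.mul_mem hcF (hLF x hx i)
  let H : AddSubgroup (Fin r → K) := G.map (DistribSMul.toAddMonoidHom (Fin r → K) c)
  have hH : (H : Set (Fin r → K)) = (fun x => c • x) '' (G : Set (Fin r → K)) := rfl
  refine ⟨⟨H, hH⟩, hcLF, ?_, ?_, ?_, hLd, ?_⟩
  · rintro d hd _ ⟨x, hx, rfl⟩
    exact ⟨d • x, hLA d hd x hx, smul_comm c d x⟩
  · obtain ⟨T, hTL, hT⟩ := hLfg
    refine ⟨T.image (fun x => c • x), ?_, ?_⟩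
    · rw [Finset.coe_image]
      exact Set.image_mono hTL
    · rintro _ ⟨x, hx, rfl⟩
      have h := AddSubgroup.mem_map_of_mem (DistribSMul.toAddMonoidHom (Fin r → K) c) (hT x hx)
      rw [AddMonoidHom.map_closure] at h
      refine AddSubgroup.closure_mono ?_ h
      rintro _ ⟨_, ⟨d, hd, t, ht, rfl⟩, rfl⟩
      exact ⟨d, hd, c • t, by simpa using ⟨t, ht, rfl⟩, smul_comm c d t⟩
  · intro y hy
    refine AddSubgroup.closure_mono ?_ (hLspan y hy)
    rintro _ ⟨d, hd, x, hx, rfl⟩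
    exact ⟨d * c⁻¹, F.mul_mem hd (F.inv_mem hcF), c • x, ⟨x, hx, rfl⟩,
      by rw [smul_smul, inv_mul_cancel_right₀ hc]⟩
  · let LA : Submodule A (Fin r → K) :=
      { G with smul_mem' := fun d x hx => hLA d d.2 x hx }
    have hLAfg : LA.FG := by
      obtain ⟨T, hTL, hT⟩ := hLfg
      refine ⟨T, le_antisymm (Submodule.span_le.2 hTL) fun x hx => ?_⟩
      refine (AddSubgroup.closure_le (Submodule.span A (T : Set (Fin r → K))).toAddSubgroup).2
        ?_ (hT x hx)
      rintro _ ⟨d, hd, t, ht, rfl⟩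
      exact (Submodule.span A _).smul_mem ⟨d, hd⟩ (Submodule.subset_span ht)
    have := hquot N hNne
    have hcard : R1.card + 1 = q ^ (r * degN) := by
      have h := card_repSet (L := LA) hAF hFrac hLF hLspan hLAfg hn ha hNn hR1
      rw [h, hdegN, ← pow_mul, mul_comm]
    have hω' := stronglyDiscrete_image_rvPair hFinfclosed
      (fun x hx i => hFFinf (hcLF x hx i)) hLd hω
    have hR1' := hR1.smul hc
    rw [← invIdl_smul hc] at hR1'
    rw [← hH] at hω' hR1' hR2 ⊢
    rw [discVal_congr hω' hR2 hR1', hH, discVal_smul hc, zpow_sub₀ hc, zpow_one,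
      ← Nat.cast_pow, ← hcard, zpow_natCast, pow_succ', div_mul_cancel_left₀ hc, inv_pow]
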